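/- For all vectors u, v, y, w ∈ ℝ⁸, with A = ⟨u,y⟩⟨v,w⟩ − ⟨u,w⟩⟨v,y⟩ and B = Φ₀(u,v,y,w), the following identity of 8-forms holds: (ι_u ι_v Φ₀) ∧ (ι_y ι_w Φ₀) ∧ Φ₀ = (6A + 7B) · vol. -/

import Mathlib

noncomputable section
open scoped RealInnerProductSpace

/-- Euclidean 8-space ℝ⁸. -/
abbrev E8 : Type := EuclideanSpace ℝ (Fin 8)

/-- The alternating 4-form `dx^i ∧ dx^j ∧ dx^k ∧ dx^l` on ℝ⁸, evaluated on four vectors. -/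
def dx4 (i j k l : Fin 8) (v : Fin 4 → E8) : ℝ :=
  Matrix.det (Matrix.of fun a b => v b (![i, j, k, l] a))

/-- The Cayley 4-form `Φ₀` on ℝ⁸ (indices written 0-based, i.e. `dx4 0 1 2 3` is `dx¹²³⁴`). -/
def Phi0 (v : Fin 4 → E8) : ℝ :=
  dx4 0 1 2 3 v + dx4 0 1 4 5 v + dx4 0 1 6 7 v + dx4 0 2 4 6 v
    - dx4 0 2 5 7 v - dx4 0 3 4 7 v - dx4 0 3 5 6 v
    - dx4 1 2 4 7 v - dx4 1 2 5 6 v - dx4 1 3 4 6 v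
    + dx4 1 3 5 7 v + dx4 2 3 4 5 v + dx4 2 3 6 7 v + dx4 4 5 6 7 v

/-- The wedge product of a `p`-form and a `q`-form on ℝ⁸ (forms represented as
functions of tuples of vectors), in the determinant convention: for alternating
`f` and `g` this is the usual exterior product, with `dx¹ ∧ ⋯ ∧ dx⁸ = vol`. -/
def wedge {p q : ℕ} (f : (Fin p → E8) → ℝ) (g : (Fin q → E8) → ℝ)
    (v : Fin (p + q) → E8) : ℝ :=
  ((p.factorial * q.factorial : ℕ) : ℝ)⁻¹ *
    ∑ σ : Equiv.Perm (Fin (p + q)),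
      ((Equiv.Perm.sign σ : ℤ) : ℝ) *
        ((f fun i => v (σ (Fin.castAdd q i))) * g fun j => v (σ (Fin.natAdd p j)))

/-- The standard volume form `vol = dx¹ ∧ ⋯ ∧ dx⁸` on ℝ⁸. -/
def vol (v : Fin 8 → E8) : ℝ := Matrix.det (Matrix.of fun a b => v b a)

/-- The contraction 2-form `ι_u ι_v Φ₀ = Φ₀(v, u, ·, ·)`. -/
def iota2 (u v : E8) (z : Fin 2 → E8) : ℝ := Phi0 ![v, u, z 0, z 1]


/-- The standard basis vectors of `ℝ⁸`. -/
def stdVec (i : Fin 8) : E8 := EuclideanSpace.single i 1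

/-- The `n`-form `⟪x 0, ·⟫ ∧ ⋯ ∧ ⟪x (n - 1), ·⟫`. -/
def decomp {n : ℕ} (x v : Fin n → E8) : ℝ :=
  Matrix.det (Matrix.of fun a b => ⟪x a, v b⟫)

lemma inner_eq_sum (x y : E8) : ⟪x, y⟫ = ∑ i, x i * y i := by
  simp [PiLp.inner_apply, mul_comm]

lemma inner_stdVec (i : Fin 8) (x : E8) : ⟪stdVec i, x⟫ = x i := by
  simp [stdVec, EuclideanSpace.inner_single_left]

lemma decomp_eq_sum {n : ℕ} (x v : Fin n → E8) :
    decomp x v = ∑ σ : Equiv.Perm (Fin n),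
      ((Equiv.Perm.sign σ : ℤ) : ℝ) * ∏ i, ⟪x i, v (σ i)⟫ := by
  rw [decomp, ← Matrix.det_transpose, Matrix.det_apply']
  rfl

lemma decomp_two (x y : E8) (z : Fin 2 → E8) :
    decomp ![x, y] z = ⟪x, z 0⟫ * ⟪y, z 1⟫ - ⟪x, z 1⟫ * ⟪y, z 0⟫ := by
  simp [decomp, Matrix.det_fin_two]

lemma dx4_eq_decomp (i j k l : Fin 8) :
    dx4 i j k l = decomp ![stdVec i, stdVec j, stdVec k, stdVec l] := by
  funext v
  unfold dx4 decomp
  congr 1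
  ext a b
  fin_cases a <;> simp [inner_stdVec]

lemma sign_mul_self_cast {n : ℕ} (σ : Equiv.Perm (Fin n)) :
    ((Equiv.Perm.sign σ : ℤ) : ℝ) * ((Equiv.Perm.sign σ : ℤ) : ℝ) = 1 := by
  rcases Int.units_eq_one_or (Equiv.Perm.sign σ) with h | h <;> simp [h]

lemma sum_sign_mul_comp_perm {n : ℕ} (S : (Fin n → E8) → ℝ) (v : Fin n → E8)
    (π : Equiv.Perm (Fin n)) :
    ∑ σ : Equiv.Perm (Fin n), ((Equiv.Perm.sign σ : ℤ) : ℝ) * S (v ∘ ⇑(σ * π)) =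
      ((Equiv.Perm.sign π : ℤ) : ℝ) *
        ∑ σ : Equiv.Perm (Fin n), ((Equiv.Perm.sign σ : ℤ) : ℝ) * S (v ∘ σ) := by
  rw [← Equiv.sum_comp (Equiv.mulRight π)
    (fun σ : Equiv.Perm (Fin n) => ((Equiv.Perm.sign σ : ℤ) : ℝ) * S (v ∘ σ)), Finset.mul_sum]
  refine Finset.sum_congr rfl fun σ _ => ?_
  simp only [Equiv.coe_mulRight, Equiv.Perm.sign_mul, Units.val_mul, Int.cast_mul]
  linear_combination (-((Equiv.Perm.sign σ : ℤ) : ℝ) * S (v ∘ ⇑(σ * π))) * sign_mul_self_cast π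

/-- The permutation of `Fin (p + q)` acting by `τ` on the first block and by `ρ` on the second. -/
def blockPerm {p q : ℕ} (τ : Equiv.Perm (Fin p)) (ρ : Equiv.Perm (Fin q)) :
    Equiv.Perm (Fin (p + q)) :=
  finSumFinEquiv.permCongr (Equiv.sumCongr τ ρ)

lemma sign_blockPerm {p q : ℕ} (τ : Equiv.Perm (Fin p)) (ρ : Equiv.Perm (Fin q)) :
    Equiv.Perm.sign (blockPerm τ ρ) = Equiv.Perm.sign τ * Equiv.Perm.sign ρ := by
  rw [blockPerm, Equiv.Perm.sign_permCongr]
  exact Equiv.Perm.sign_sumCongr τ ρ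

lemma blockPerm_castAdd {p q : ℕ} (τ : Equiv.Perm (Fin p)) (ρ : Equiv.Perm (Fin q)) (i : Fin p) :
    blockPerm τ ρ (Fin.castAdd q i) = Fin.castAdd q (τ i) := by
  simp [blockPerm, Equiv.permCongr_apply]

lemma blockPerm_natAdd {p q : ℕ} (τ : Equiv.Perm (Fin p)) (ρ : Equiv.Perm (Fin q)) (j : Fin q) :
    blockPerm τ ρ (Fin.natAdd p j) = Fin.natAdd p (ρ j) := by
  simp [blockPerm, Equiv.permCongr_apply]

/-- The wedge product of decomposable forms concatenates their factors. -/
lemma wedge_decomp {p q : ℕ} (x : Fin p → E8) (y : Fin q → E8) :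
    wedge (decomp x) (decomp y) = decomp (Fin.append x y) := by
  funext v
  let S : (Fin (p + q) → E8) → ℝ := fun z => ∏ i, ⟪Fin.append x y i, z i⟫
  have hD : decomp (Fin.append x y) v = ∑ σ : Equiv.Perm (Fin (p + q)),
      ((Equiv.Perm.sign σ : ℤ) : ℝ) * S (v ∘ σ) := decomp_eq_sum _ _
  have hS : ∀ (σ : Equiv.Perm (Fin (p + q))) (τ : Equiv.Perm (Fin p)) (ρ : Equiv.Perm (Fin q)),
      S (v ∘ ⇑(σ * blockPerm τ ρ)) = (∏ i, ⟪x i, v (σ (Fin.castAdd q (τ i)))⟫) *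
        ∏ j, ⟪y j, v (σ (Fin.natAdd p (ρ j)))⟫ := by
    intro σ τ ρ
    simp [S, Fin.prod_univ_add, blockPerm_castAdd, blockPerm_natAdd]
  have key : ∑ σ : Equiv.Perm (Fin (p + q)), ((Equiv.Perm.sign σ : ℤ) : ℝ) *
      ((decomp x fun i => v (σ (Fin.castAdd q i))) * decomp y fun j => v (σ (Fin.natAdd p j))) =
      ∑ τ : Equiv.Perm (Fin p), ∑ ρ : Equiv.Perm (Fin q), decomp (Fin.append x y) v := by
    have h1 : ∀ σ : Equiv.Perm (Fin (p + q)), ((Equiv.Perm.sign σ : ℤ) : ℝ) *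
        ((decomp x fun i => v (σ (Fin.castAdd q i))) *
          decomp y fun j => v (σ (Fin.natAdd p j))) =
        ∑ τ : Equiv.Perm (Fin p), ∑ ρ : Equiv.Perm (Fin q),
          (((Equiv.Perm.sign τ : ℤ) : ℝ) * ((Equiv.Perm.sign ρ : ℤ) : ℝ)) *
            (((Equiv.Perm.sign σ : ℤ) : ℝ) * S (v ∘ ⇑(σ * blockPerm τ ρ))) := by
      intro σ
      rw [decomp_eq_sum, decomp_eq_sum, Finset.sum_mul_sum, Finset.mul_sum]
      refine Finset.sum_congr rfl fun τ _ => ?_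
      rw [Finset.mul_sum]
      refine Finset.sum_congr rfl fun ρ _ => ?_
      rw [hS]
      ring
    simp only [h1]
    rw [Finset.sum_comm]
    refine Finset.sum_congr rfl fun τ _ => ?_
    rw [Finset.sum_comm]
    refine Finset.sum_congr rfl fun ρ _ => ?_
    rw [← Finset.mul_sum, sum_sign_mul_comp_perm, sign_blockPerm, ← hD]
    push_cast
    linear_combination (((Equiv.Perm.sign ρ : ℤ) : ℝ) * ((Equiv.Perm.sign ρ : ℤ) : ℝ) *
      decomp (Fin.append x y) v) * sign_mul_self_cast τ +
        decomp (Fin.append x y) v * sign_mul_self_cast ρ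
  have hp : (p.factorial : ℝ) ≠ 0 := by exact_mod_cast p.factorial_ne_zero
  have hq : (q.factorial : ℝ) ≠ 0 := by exact_mod_cast q.factorial_ne_zero
  rw [wedge, key]
  simp only [Finset.sum_const, Finset.card_univ, Fintype.card_perm, Fintype.card_fin,
    nsmul_eq_mul]
  push_cast
  field_simp

lemma wedge_sum_left {p q : ℕ} {ι : Type*} (s : Finset ι) (f : ι → (Fin p → E8) → ℝ)
    (g : (Fin q → E8) → ℝ) :
    wedge (∑ i ∈ s, f i) g = ∑ i ∈ s, wedge (f i) g := by
  funext v
  simp only [wedge, Finset.sum_apply, Finset.sum_mul, Finset.mul_sum]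
  rw [Finset.sum_comm]

lemma wedge_sum_right {p q : ℕ} {ι : Type*} (s : Finset ι) (f : (Fin p → E8) → ℝ)
    (g : ι → (Fin q → E8) → ℝ) :
    wedge f (∑ i ∈ s, g i) = ∑ i ∈ s, wedge f (g i) := by
  funext v
  simp only [wedge, Finset.sum_apply, Finset.mul_sum]
  rw [Finset.sum_comm]

lemma wedge_add_right {p q : ℕ} (f : (Fin p → E8) → ℝ) (g h : (Fin q → E8) → ℝ) :
    wedge f (g + h) = wedge f g + wedge f h := by
  funext v
  simp only [wedge, Pi.add_apply, mul_add, Finset.sum_add_distrib]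

lemma wedge_sub_right {p q : ℕ} (f : (Fin p → E8) → ℝ) (g h : (Fin q → E8) → ℝ) :
    wedge f (g - h) = wedge f g - wedge f h := by
  funext v
  simp only [wedge, Pi.sub_apply, mul_sub, Finset.sum_sub_distrib]

lemma decomp_eight (x v : Fin 8 → E8) :
    decomp x v = Matrix.det (Matrix.of fun a b => x a b) * vol v := by
  rw [decomp, vol, ← Matrix.det_mul]
  congr 1
  ext a b
  simp [Matrix.mul_apply, inner_eq_sum]

lemma dx4_apply (i j k l : Fin 8) (x : Fin 4 → E8) : dx4 i j k l x =
    x 0 i * (x 1 j * (x 2 k * x 3 l - x 3 k * x 2 l) - x 2 j * (x 1 k * x 3 l - x 3 k * x 1 l)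
      + x 3 j * (x 1 k * x 2 l - x 2 k * x 1 l))
    - x 1 i * (x 0 j * (x 2 k * x 3 l - x 3 k * x 2 l) - x 2 j * (x 0 k * x 3 l - x 3 k * x 0 l)
      + x 3 j * (x 0 k * x 2 l - x 2 k * x 0 l))
    + x 2 i * (x 0 j * (x 1 k * x 3 l - x 3 k * x 1 l) - x 1 j * (x 0 k * x 3 l - x 3 k * x 0 l)
      + x 3 j * (x 0 k * x 1 l - x 1 k * x 0 l))
    - x 3 i * (x 0 j * (x 1 k * x 2 l - x 2 k * x 1 l) - x 1 j * (x 0 k * x 2 l - x 2 k * x 0 l)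
      + x 2 j * (x 0 k * x 1 l - x 1 k * x 0 l)) := by
  simp [dx4, Matrix.det_succ_row_zero, Fin.sum_univ_succ, Fin.succAbove]
  ring

/-- The determinant of four vectors followed by the standard vectors `e_i, e_j, e_k, e_l`. -/
def coordDet (x : Fin 4 → E8) (i j k l : Fin 8) : ℝ :=
  Matrix.det (Matrix.of
    fun a b => (![stdVec i, stdVec j, stdVec k, stdVec l, x 0, x 1, x 2, x 3] : Fin 8 → E8) a b)

lemma wedge_decomp_dx4 (x : Fin 4 → E8) (i j k l : Fin 8) (v : Fin 8 → E8) :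
    wedge (p := 4) (decomp x) (dx4 i j k l) v = coordDet x i j k l * vol v := by
  rw [dx4_eq_decomp, wedge_decomp]
  refine (decomp_eight _ v).trans ?_
  congr 1
  have hs : Equiv.Perm.sign (Equiv.addRight (4 : Fin 8)) = 1 := by decide
  have h := Matrix.det_permute (Equiv.addRight (4 : Fin 8)) (Matrix.of
    fun a b => (![stdVec i, stdVec j, stdVec k, stdVec l, x 0, x 1, x 2, x 3] : Fin 8 → E8) a b)
  rw [hs] at h
  simp only [Units.val_one, Int.cast_one, one_mul] at h
  rw [coordDet, ← h]
  congr 1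
  ext a b
  fin_cases a <;> rfl

lemma coordDet_eq (x : Fin 4 → E8) (f g : Fin 8 → Fin 8) (h₁ : Function.LeftInverse g f)
    (h₂ : Function.RightInverse g f)
    (hs : Equiv.Perm.sign (⟨f, g, h₁, h₂⟩ : Equiv.Perm (Fin 8)) = 1) :
    coordDet x (f 0) (f 1) (f 2) (f 3) = dx4 (f 4) (f 5) (f 6) (f 7) x := by
  have h := Matrix.det_permute' ⟨f, g, h₁, h₂⟩ (Matrix.of fun a b =>
    (![stdVec (f 0), stdVec (f 1), stdVec (f 2), stdVec (f 3), x 0, x 1, x 2, x 3] :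
      Fin 8 → E8) a b)
  rw [hs] at h
  simp only [Units.val_one, Int.cast_one, one_mul] at h
  rw [coordDet, ← h, ← Matrix.det_reindex_self (finSumFinEquiv (m := 4) (n := 4)).symm, dx4,
    ← Matrix.det_transpose (Matrix.of fun a b => x b (![f 4, f 5, f 6, f 7] a))]
  set X := (Matrix.of fun a b => x b (![f 4, f 5, f 6, f 7] a)).transpose
  have hb : ∀ {M : Matrix (Fin 4 ⊕ Fin 4) (Fin 4 ⊕ Fin 4) ℝ}, M.toBlocks₁₁ = 1 →
      M.toBlocks₁₂ = 0 → M.toBlocks₂₂ = X → M.det = X.det := by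
    intro M h11 h12 h22
    rw [← Matrix.fromBlocks_toBlocks M, h11, h12, h22, Matrix.det_fromBlocks_zero₁₂]
    simp
  have hf : ∀ a b : Fin 8, f b = f a ↔ b = a := fun a b => h₁.injective.eq_iff
  refine hb ?_ ?_ ?_
  · ext a b
    fin_cases a <;> fin_cases b <;>
      simp [Matrix.toBlocks₁₁, stdVec, hf, finSumFinEquiv]
  · ext a b
    fin_cases a <;> fin_cases b <;>
      simp [Matrix.toBlocks₁₂, stdVec, hf, finSumFinEquiv]
  · ext a b
    fin_cases a <;> fin_cases b <;> rfl

lemma wedge_decomp_Phi0 (x : Fin 4 → E8) (v : Fin 8 → E8) :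
    wedge (p := 4) (decomp x) Phi0 v = Phi0 x * vol v := by
  have hΦ : Phi0 = dx4 0 1 2 3 + dx4 0 1 4 5 + dx4 0 1 6 7 + dx4 0 2 4 6
    - dx4 0 2 5 7 - dx4 0 3 4 7 - dx4 0 3 5 6
    - dx4 1 2 4 7 - dx4 1 2 5 6 - dx4 1 3 4 6
    + dx4 1 3 5 7 + dx4 2 3 4 5 + dx4 2 3 6 7 + dx4 4 5 6 7 := rfl
  rw [hΦ]
  simp only [wedge_add_right, wedge_sub_right, Pi.add_apply, Pi.sub_apply, wedge_decomp_dx4]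
  have h0123 : coordDet x 0 1 2 3 = dx4 4 5 6 7 x :=
    coordDet_eq x ![0, 1, 2, 3, 4, 5, 6, 7] ![0, 1, 2, 3, 4, 5, 6, 7]
      (by decide) (by decide) (by decide)
  have h0145 : coordDet x 0 1 4 5 = dx4 2 3 6 7 x :=
    coordDet_eq x ![0, 1, 4, 5, 2, 3, 6, 7] ![0, 1, 4, 5, 2, 3, 6, 7]
      (by decide) (by decide) (by decide)
  have h0167 : coordDet x 0 1 6 7 = dx4 2 3 4 5 x :=
    coordDet_eq x ![0, 1, 6, 7, 2, 3, 4, 5] ![0, 1, 4, 5, 6, 7, 2, 3]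
      (by decide) (by decide) (by decide)
  have h0246 : coordDet x 0 2 4 6 = dx4 1 3 5 7 x :=
    coordDet_eq x ![0, 2, 4, 6, 1, 3, 5, 7] ![0, 4, 1, 5, 2, 6, 3, 7]
      (by decide) (by decide) (by decide)
  have h0257 : coordDet x 0 2 5 7 = dx4 1 3 4 6 x :=
    coordDet_eq x ![0, 2, 5, 7, 1, 3, 4, 6] ![0, 4, 1, 5, 6, 2, 7, 3]
      (by decide) (by decide) (by decide)
  have h0347 : coordDet x 0 3 4 7 = dx4 1 2 5 6 x :=
    coordDet_eq x ![0, 3, 4, 7, 1, 2, 5, 6] ![0, 4, 5, 1, 2, 6, 7, 3]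
      (by decide) (by decide) (by decide)
  have h0356 : coordDet x 0 3 5 6 = dx4 1 2 4 7 x :=
    coordDet_eq x ![0, 3, 5, 6, 1, 2, 4, 7] ![0, 4, 5, 1, 6, 2, 3, 7]
      (by decide) (by decide) (by decide)
  have h1247 : coordDet x 1 2 4 7 = dx4 0 3 5 6 x :=
    coordDet_eq x ![1, 2, 4, 7, 0, 3, 5, 6] ![4, 0, 1, 5, 2, 6, 7, 3]
      (by decide) (by decide) (by decide)
  have h1256 : coordDet x 1 2 5 6 = dx4 0 3 4 7 x :=
    coordDet_eq x ![1, 2, 5, 6, 0, 3, 4, 7] ![4, 0, 1, 5, 6, 2, 3, 7]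
      (by decide) (by decide) (by decide)
  have h1346 : coordDet x 1 3 4 6 = dx4 0 2 5 7 x :=
    coordDet_eq x ![1, 3, 4, 6, 0, 2, 5, 7] ![4, 0, 5, 1, 2, 6, 3, 7]
      (by decide) (by decide) (by decide)
  have h1357 : coordDet x 1 3 5 7 = dx4 0 2 4 6 x :=
    coordDet_eq x ![1, 3, 5, 7, 0, 2, 4, 6] ![4, 0, 5, 1, 6, 2, 7, 3]
      (by decide) (by decide) (by decide)
  have h2345 : coordDet x 2 3 4 5 = dx4 0 1 6 7 x :=
    coordDet_eq x ![2, 3, 4, 5, 0, 1, 6, 7] ![4, 5, 0, 1, 2, 3, 6, 7]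
      (by decide) (by decide) (by decide)
  have h2367 : coordDet x 2 3 6 7 = dx4 0 1 4 5 x :=
    coordDet_eq x ![2, 3, 6, 7, 0, 1, 4, 5] ![4, 5, 0, 1, 6, 7, 2, 3]
      (by decide) (by decide) (by decide)
  have h4567 : coordDet x 4 5 6 7 = dx4 0 1 2 3 x :=
    coordDet_eq x ![4, 5, 6, 7, 0, 1, 2, 3] ![4, 5, 6, 7, 0, 1, 2, 3]
      (by decide) (by decide) (by decide)
  rw [h0123, h0145, h0167, h0246, h0257, h0347, h0356,
    h1247, h1256, h1346, h1357, h2345, h2367, h4567]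
  ring

/-- The 2-form `dx^i ∧ dx^j`. -/
def dx2 (i j : Fin 8) (u v : E8) : ℝ := u i * v j - u j * v i

/-- A basis of the 2-forms on which wedging with the Cayley form acts as three times Hodge star. -/
def omega : Fin 7 → E8 → E8 → ℝ :=
  ![fun u v => dx2 0 1 u v + dx2 2 3 u v + dx2 4 5 u v + dx2 6 7 u v,
    fun u v => dx2 0 2 u v - dx2 1 3 u v + dx2 4 6 u v - dx2 5 7 u v,
    fun u v => dx2 0 3 u v + dx2 1 2 u v - dx2 4 7 u v - dx2 5 6 u v,
    fun u v => dx2 0 4 u v - dx2 1 5 u v - dx2 2 6 u v + dx2 3 7 u v,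
    fun u v => dx2 0 5 u v + dx2 1 4 u v + dx2 2 7 u v + dx2 3 6 u v,
    fun u v => dx2 0 6 u v - dx2 1 7 u v + dx2 2 4 u v - dx2 3 5 u v,
    fun u v => dx2 0 7 u v + dx2 1 6 u v - dx2 2 5 u v - dx2 3 4 u v]

/-- The Cayley form in terms of the 2-forms `omega m` and the inner product. -/
lemma Phi0_eq_omega (u v y w : E8) :
    Phi0 ![u, v, y, w] =
      ∑ m, omega m u v * omega m y w - (⟪u, y⟫ * ⟪v, w⟫ - ⟪u, w⟫ * ⟪v, y⟫) := by
  simp only [Phi0, dx4_apply, inner_eq_sum, Fin.sum_univ_eight, Fin.sum_univ_seven, omega, dx2,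
    Matrix.cons_val]
  ring

/-- The vectors `R c` for which `∑ m, b m • omega m = ∑ c, e_c ∧ R c`. -/
def halfContraction (b : Fin 7 → ℝ) (c : Fin 8) : E8 :=
  WithLp.toLp 2 fun i => 2⁻¹ * ∑ m, b m * omega m (stdVec c) (stdVec i)

lemma stdVec_apply (i j : Fin 8) : stdVec i j = if j = i then 1 else 0 := by
  simp [stdVec]

lemma sum_decomp_halfContraction (b : Fin 7 → ℝ) (z : Fin 2 → E8) :
    ∑ c, decomp ![stdVec c, halfContraction b c] z = ∑ m, b m * omega m (z 0) (z 1) := by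
  simp only [decomp_two, inner_eq_sum, halfContraction, Fin.sum_univ_eight,
    Fin.sum_univ_seven, omega, dx2, Matrix.cons_val, stdVec_apply]
  simp
  ring

lemma sum_dx2_halfContraction (b : Fin 7 → ℝ) (i j : Fin 8) :
    ∑ c, dx2 i j (stdVec c) (halfContraction b c) =
      ∑ m, b m * omega m (stdVec i) (stdVec j) := by
  have h := sum_decomp_halfContraction b ![stdVec i, stdVec j]
  simp only [Matrix.cons_val] at h
  rw [← h]
  refine Finset.sum_congr rfl fun c _ => ?_
  simp only [decomp_two, Matrix.cons_val, real_inner_comm (stdVec i) (halfContraction b c),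
    real_inner_comm (stdVec j) (halfContraction b c)]
  simp [inner_stdVec, dx2, stdVec_apply, eq_comm]

lemma sum_omega_halfContraction (b : Fin 7 → ℝ) (m : Fin 7) :
    ∑ c, omega m (stdVec c) (halfContraction b c) = 4 * b m := by
  fin_cases m <;>
  · simp only [omega, Fin.reduceFinMk, Matrix.cons_val, Finset.sum_add_distrib,
      Finset.sum_sub_distrib, sum_dx2_halfContraction]
    simp [Fin.sum_univ_seven, dx2, stdVec_apply]
    ring

lemma sum_Phi0_halfContraction (b : Fin 7 → ℝ) (x y : E8) :
    ∑ c, Phi0 ![x, y, stdVec c, halfContraction b c] = 3 * ∑ m, b m * omega m x y := by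
  have h₁ : ∑ c, ∑ m, omega m x y * omega m (stdVec c) (halfContraction b c) =
      4 * ∑ m, b m * omega m x y := by
    rw [Finset.sum_comm, Finset.mul_sum]
    refine Finset.sum_congr rfl fun m _ => ?_
    rw [← Finset.mul_sum, sum_omega_halfContraction]
    ring
  have h₂ : ∑ c, (⟪x, stdVec c⟫ * ⟪y, halfContraction b c⟫ -
      ⟪x, halfContraction b c⟫ * ⟪y, stdVec c⟫) = ∑ m, b m * omega m x y := by
    refine Eq.trans ?_ (sum_decomp_halfContraction b ![x, y])
    refine Finset.sum_congr rfl fun c _ => ?_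
    simp only [decomp_two, Matrix.cons_val]
    rw [real_inner_comm x (stdVec c),
      real_inner_comm x (halfContraction b c), real_inner_comm y (stdVec c),
      real_inner_comm y (halfContraction b c)]
    ring
  simp only [Phi0_eq_omega]
  rw [Finset.sum_sub_distrib, h₁, h₂]
  ring

lemma omega_swap (m : Fin 7) (u v : E8) : omega m v u = -omega m u v := by
  fin_cases m <;> simp [omega, dx2] <;> ring

lemma Phi0_swap_pairs (u v y w : E8) : Phi0 ![u, v, y, w] = Phi0 ![y, w, u, v] := by
  simp only [Phi0_eq_omega, mul_comm (omega _ u v), real_inner_comm u, real_inner_comm v]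
  ring

/-- The vectors occurring in the decomposition of `iota2 u v` into nine decomposable 2-forms. -/
def iotaFactor (u v : E8) : Option (Fin 8) → Fin 2 → E8
  | none => ![u, v]
  | some c => ![stdVec c, halfContraction (fun m => -omega m u v) c]

lemma iota2_eq_sum (u v : E8) : iota2 u v = ∑ t, decomp (iotaFactor u v t) := by
  funext z
  simp only [Finset.sum_apply, Fintype.sum_option, iotaFactor, sum_decomp_halfContraction]
  simp only [iota2, Phi0_eq_omega, decomp_two, omega_swap _ u v]
  ring

lemma wedge_wedge_decomp_Phi0 (x y : Fin 2 → E8) (v : Fin 8 → E8) :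
    wedge (wedge (decomp x) (decomp y)) Phi0 v = Phi0 ![x 0, x 1, y 0, y 1] * vol v := by
  rw [wedge_decomp]
  refine (wedge_decomp_Phi0 _ v).trans ?_
  congr 2
  ext a
  fin_cases a <;> rfl

/-- For all `u, v, y, w ∈ ℝ⁸`, with `A = ⟨u,y⟩⟨v,w⟩ − ⟨u,w⟩⟨v,y⟩` and
`B = Φ₀(u,v,y,w)`, one has `(ι_u ι_v Φ₀) ∧ (ι_y ι_w Φ₀) ∧ Φ₀ = (6A + 7B) · vol`. -/
theorem contraction_wedge_contraction_wedge_Phi (u v y w : E8) (vv : Fin 8 → E8) :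
    wedge (wedge (iota2 u v) (iota2 y w)) Phi0 vv =
      (6 * (⟪u, y⟫ * ⟪v, w⟫ - ⟪u, w⟫ * ⟪v, y⟫) + 7 * Phi0 ![u, v, y, w]) * vol vv := by
  have hsum : wedge (wedge (iota2 u v) (iota2 y w)) Phi0 vv =
      (∑ s, ∑ t, Phi0 ![iotaFactor u v s 0, iotaFactor u v s 1,
        iotaFactor y w t 0, iotaFactor y w t 1]) * vol vv := by
    rw [iota2_eq_sum u v, iota2_eq_sum y w]
    simp only [wedge_sum_left, wedge_sum_right, Finset.sum_apply, wedge_wedge_decomp_Phi0,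
      Finset.sum_mul]
    rw [Finset.sum_comm]
  rw [hsum]
  congr 1
  have hmixed : ∑ c, Phi0 ![stdVec c, halfContraction (fun m => -omega m u v) c, y, w] =
      3 * ∑ m, -omega m u v * omega m y w := by
    simp only [fun c b => Phi0_swap_pairs (stdVec c) b y w]
    exact sum_Phi0_halfContraction _ y w
  have hboth : ∑ c, ∑ m, -omega m y w *
        omega m (stdVec c) (halfContraction (fun m => -omega m u v) c) =
      4 * ∑ m, omega m u v * omega m y w := by
    rw [Finset.sum_comm, Finset.mul_sum]
    refine Finset.sum_congr rfl fun m _ => ?_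
    rw [← Finset.mul_sum, sum_omega_halfContraction]
    ring
  simp only [Fintype.sum_option, iotaFactor, Matrix.cons_val_zero, Matrix.cons_val_one,
    Finset.sum_add_distrib, hmixed, sum_Phi0_halfContraction, ← Finset.mul_sum, hboth]
  rw [Phi0_eq_omega u v y w]
  simp only [neg_mul, Finset.sum_neg_distrib, mul_comm (omega _ y w)]
  ring
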